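/- arXiv:1907.03437 — 4 statements merged into one kernel-verified Lean document; each statement's English description precedes it below -/
import Mathlib

section
/- Cross-iteration agreement with honest persistence (core of the Agreement theorems for RBA and HBA): let t be a natural number, S a finite set of nodes with |S| ≤ 3t+1, B ⊆ S with |B| ≤ t, V a type of values, and pc : ℕ → S → V a function assigning to each iteration r and node x the value x pre-commits at iteration r. Say a value v is quorum-certified at iteration r if there exists Q ⊆ S with |Q| ≥ 2t+1 and pc r x = v for all x ∈ Q \ B. Suppose v_p is quorum-certified at iteration r_p via a quorum P (i.e., P ⊆ S, |P| ≥ 2t+1, and pc r_p x = v_p for every x ∈ P \ B), and suppose the honest members of P persist on v_p: for every x ∈ P \ B and every iteration r > r_p, if no value v' ≠ v_p is quorum-certified at any iteration r' with r_p < r' < r, then pc r x = v_p. Then for every iteration r > r_p, every value that is quorum-certified at r equals v_p. -/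
/-- Two quorums in a system of at most `3 * t + 1` nodes, at most `t` of them Byzantine,
share an honest node. -/
theorem exists_honest_mem_inter_of_quorums {α : Type*} [DecidableEq α] {t : ℕ}
    {S B P Q : Finset α} (hS : S.card ≤ 3 * t + 1) (hB : B.card ≤ t)
    (hP : P ⊆ S) (hPcard : 2 * t + 1 ≤ P.card) (hQ : Q ⊆ S) (hQcard : 2 * t + 1 ≤ Q.card) :
    ∃ x ∈ P ∩ Q, x ∉ B := by
  apply Finset.exists_mem_notMem_of_card_lt_card
  have hunion := Finset.card_le_card (Finset.union_subset hP hQ)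
  have hinter := Finset.card_union_add_card_inter P Q
  omega

/-- Cross-iteration agreement with honest persistence: if `v_p` is quorum-certified at
iteration `r_p` via `P` and the honest members of `P` persist on `v_p` (as long as no
conflicting value has been quorum-certified at a strictly intermediate iteration),
then every value quorum-certified at any later iteration equals `v_p`. -/
theorem cross_iteration_agreement {α V : Type*} [DecidableEq α]
    (t : ℕ) (S B P : Finset α) (pc : ℕ → α → V) (v_p : V) (r_p : ℕ)
    (hS : S.card ≤ 3 * t + 1)
    (hBS : B ⊆ S) (hB : B.card ≤ t)
    (hP : P ⊆ S) (hPcard : 2 * t + 1 ≤ P.card)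
    (hPv : ∀ x ∈ P \ B, pc r_p x = v_p)
    (persist : ∀ x ∈ P \ B, ∀ r, r_p < r →
      (∀ v', v' ≠ v_p → ∀ r', r_p < r' → r' < r →
        ¬ (∃ Q : Finset α, Q ⊆ S ∧ 2 * t + 1 ≤ Q.card ∧ ∀ y ∈ Q \ B, pc r' y = v')) →
      pc r x = v_p) :
    ∀ r, r_p < r → ∀ v,
      (∃ Q : Finset α, Q ⊆ S ∧ 2 * t + 1 ≤ Q.card ∧ ∀ y ∈ Q \ B, pc r y = v) →
      v = v_p := by
  intro r
  induction r using Nat.strong_induction_on with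
  | _ r ih =>
    rintro hr v ⟨Q, hQ, hQcard, hQv⟩
    obtain ⟨x, hx, hxB⟩ := exists_honest_mem_inter_of_quorums hS hB hP hPcard hQ hQcard
    obtain ⟨hxP, hxQ⟩ := Finset.mem_inter.mp hx
    rw [← hQv x (Finset.mem_sdiff.mpr ⟨hxQ, hxB⟩)]
    exact persist x (Finset.mem_sdiff.mpr ⟨hxP, hxB⟩) r hr
      fun v' hv' r' hr' hlt hcert => hv' (ih r' hlt hr' v' hcert)
end

section
/- Expected eight-round termination bound: for all natural numbers t and n with 3t+1 ≤ n, the real-valued sum ∑_{i=0}^{t} ((t/n)^i · ((n−t)/n) · (6+4i)) is at most 8. -/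
/-- A partial-sum bound for the arithmetico-geometric series with ratio `x ≤ 1/3`, including the
slack left for the remaining terms. -/
theorem sum_geometric_rounds_add_le {x : ℝ} (hx0 : 0 ≤ x) (hx : x ≤ 1 / 3) (m : ℕ) :
    ∑ i ∈ Finset.range m, x ^ i * (1 - x) * (6 + 4 * (i : ℝ)) + x ^ m * (8 + 4 * (m : ℝ)) ≤ 8 := by
  induction m with
  | zero => simp
  | succ m ih =>
    rw [Finset.sum_range_succ, pow_succ]
    push_cast
    have key : 0 ≤ x ^ m * (2 - 6 * x) := mul_nonneg (pow_nonneg hx0 m) (by linarith)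
    linarith

/-- Expected eight-round termination bound: for `3t+1 ≤ n`,
`∑_{i=0}^{t} (t/n)ⁱ·((n−t)/n)·(6+4i) ≤ 8` over the reals. -/
theorem expected_eight_rounds (t n : ℕ) (h : 3 * t + 1 ≤ n) :
    ∑ i ∈ Finset.range (t + 1),
        ((t : ℝ) / n) ^ i * (((n : ℝ) - t) / n) * (6 + 4 * (i : ℝ)) ≤ 8 := by
  have hn : (0 : ℝ) < n := by exact_mod_cast (by omega : 0 < n)
  have h3 : 3 * (t : ℝ) + 1 ≤ n := by exact_mod_cast h
  have hx0 : 0 ≤ (t : ℝ) / n := by positivity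
  have hx : (t : ℝ) / n ≤ 1 / 3 := by
    rw [div_le_div_iff₀ hn (by norm_num)]
    linarith
  rw [sub_div, div_self hn.ne']
  have hslack : 0 ≤ ((t : ℝ) / n) ^ (t + 1) * (8 + 4 * ((t + 1 : ℕ) : ℝ)) := by positivity
  linarith [sum_geometric_rounds_add_le hx0 hx (t + 1)]
end

section
/- Ideal-world fairness of leader election (core of Lemma 4): let n ≥ 1 and m ≥ 1 be natural numbers, and consider the product probability measure on functions f : Fin n → Fin m obtained from n independent copies of the uniform probability measure on Fin m. For every coordinate q : Fin n, the probability of the event {f | ∀ i, f q ≤ f i} (i.e., node q attains the minimum value) is at least 1/n. -/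
open MeasureTheory ENNReal

/-- Under a product of copies of one measure, all coordinates are equally likely to attain the
minimum. -/
lemma measure_pi_forall_le_eq {ι α : Type*} [Fintype ι] [MeasurableSpace α] [LE α]
    (ν : Measure α) [SigmaFinite ν] (p q : ι) :
    Measure.pi (fun _ : ι => ν) {f : ι → α | ∀ i, f p ≤ f i} =
      Measure.pi (fun _ : ι => ν) {f : ι → α | ∀ i, f q ≤ f i} := by
  classical
  have h := (measurePreserving_piCongrLeft (fun _ : ι => ν) (Equiv.swap p q)).measure_preimage_equiv
    {f : ι → α | ∀ i, f q ≤ f i}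
  rw [← h]
  congr 1
  ext f
  have key (i : ι) : MeasurableEquiv.piCongrLeft (fun _ : ι => α) (Equiv.swap p q) f i =
      f (Equiv.swap p q i) := by
    simpa [MeasurableEquiv.coe_piCongrLeft] using
      Equiv.piCongrLeft_apply_apply (fun _ : ι => α) (Equiv.swap p q) f
        (Equiv.swap p q i)
  simp only [Set.mem_ofPred_eq, Set.mem_preimage, key, Equiv.swap_apply_right]
  exact (Equiv.swap p q).forall_congr_right (q := fun i => f p ≤ f i) |>.symm

/-- Under a product of copies of one probability measure, each coordinate attains the minimum
with probability at least the inverse of the number of coordinates. -/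
lemma one_div_card_le_measure_pi_forall_le {ι α : Type*} [Fintype ι] [MeasurableSpace α]
    [LinearOrder α] (ν : Measure α) [IsProbabilityMeasure ν] (q : ι) :
    (1 : ℝ≥0∞) / Fintype.card ι ≤ Measure.pi (fun _ : ι => ν) {f : ι → α | ∀ i, f q ≤ f i} := by
  have : Nonempty ι := ⟨q⟩
  have hcover : (⋃ p : ι, {f : ι → α | ∀ i, f p ≤ f i}) = Set.univ :=
    Set.eq_univ_of_forall fun f => Set.mem_iUnion.2 (Finite.exists_min f)
  apply ENNReal.div_le_of_le_mul
  calc (1 : ℝ≥0∞) = Measure.pi (fun _ : ι => ν) (⋃ p : ι, {f : ι → α | ∀ i, f p ≤ f i}) := by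
        rw [hcover, measure_univ]
    _ ≤ ∑ p : ι, Measure.pi (fun _ : ι => ν) {f : ι → α | ∀ i, f p ≤ f i} :=
        measure_iUnion_fintype_le _ _
    _ = Measure.pi (fun _ : ι => ν) {f : ι → α | ∀ i, f q ≤ f i} * Fintype.card ι := by
        simp [measure_pi_forall_le_eq ν _ q, mul_comm]

/-- Ideal-world fairness of leader election: under the product of `n` independent
uniform distributions on `Fin m`, each coordinate `q` attains the minimum with
probability at least `1/n`. -/
theorem ideal_leader_election_fair (n m : ℕ) [NeZero n] [NeZero m] (q : Fin n) :
    (1 : ℝ≥0∞) / n ≤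
      Measure.pi (fun _ : Fin n => (PMF.uniformOfFintype (Fin m)).toMeasure)
        {f : Fin n → Fin m | ∀ i, f q ≤ f i} := by
  simpa only [Fintype.card_fin] using
    one_div_card_le_measure_pi_forall_le (PMF.uniformOfFintype (Fin m)).toMeasure q
end

section
/- Strict-minimum leader probability with collision loss: let n ≥ 1 and m ≥ 1 be natural numbers, and consider the product probability measure on functions f : Fin n → Fin m obtained from n independent copies of the uniform probability measure on Fin m. For every coordinate q : Fin n, the probability of the event {f | ∀ i ≠ q, f q < f i} (i.e., node q is the unique minimizer) is at least 1/n − (n−1)/m. -/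
open MeasureTheory ENNReal

section

variable {ι α : Type*} [Fintype ι] [MeasurableSpace α]

/-- The `i`-th coordinate is a weak minimizer with the same probability for every `i`. -/
theorem measure_pi_isMin_eq [LE α] (ν : Measure α) [IsProbabilityMeasure ν] (i j : ι) :
    Measure.pi (fun _ : ι => ν) {f | ∀ k, f i ≤ f k} =
      Measure.pi (fun _ : ι => ν) {f | ∀ k, f j ≤ f k} := by
  classical
  have h := (measurePreserving_piCongrLeft (fun _ : ι => ν) (Equiv.swap i j)).measure_preimage_equiv
    {f | ∀ k, f i ≤ f k}
  rw [← h]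
  congr 1
  ext f
  have key (k : ι) : MeasurableEquiv.piCongrLeft (fun _ : ι => α) (Equiv.swap i j) f k =
      f (Equiv.swap i j k) := by
    obtain ⟨l, rfl⟩ := (Equiv.swap i j).surjective k
    rw [MeasurableEquiv.piCongrLeft_apply_apply, Equiv.swap_apply_self]
  simp only [Set.mem_preimage, Set.mem_ofPred_eq, key, Equiv.swap_apply_left]
  exact (Equiv.swap i j).forall_congr_left.trans (by simp)

/-- Every coordinate is a weak minimizer with probability at least the inverse of the number of
coordinates. -/
theorem inv_card_le_measure_pi_isMin [LinearOrder α] (ν : Measure α) [IsProbabilityMeasure ν]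
    (i : ι) :
    (Fintype.card ι : ℝ≥0∞)⁻¹ ≤ Measure.pi (fun _ : ι => ν) {f | ∀ k, f i ≤ f k} := by
  have : Nonempty ι := ⟨i⟩
  have hcover : (⋃ j, {f : ι → α | ∀ k, f j ≤ f k}) = Set.univ := by
    refine Set.eq_univ_of_forall fun f => ?_
    obtain ⟨j, hj⟩ := Finite.exists_min f
    exact Set.mem_iUnion.2 ⟨j, hj⟩
  have h : 1 ≤ ∑ j, Measure.pi (fun _ : ι => ν) {f | ∀ k, f j ≤ f k} := by
    rw [← measure_univ (μ := Measure.pi (fun _ : ι => ν)), ← hcover]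
    exact measure_iUnion_fintype_le _ _
  simp_rw [measure_pi_isMin_eq ν _ i] at h
  rw [Finset.sum_const, Finset.card_univ, nsmul_eq_mul] at h
  rw [ENNReal.inv_le_iff_le_mul (by simp) (by simp)]
  exact h

/-- Two distinct coordinates, each uniform on `α`, collide with probability at most
`1 / card α`. -/
theorem measure_pi_uniformOfFintype_collision_le [Fintype α] [Nonempty α]
    [MeasurableSingletonClass α] {i j : ι} (hij : i ≠ j) :
    Measure.pi (fun _ : ι => (PMF.uniformOfFintype α).toMeasure) {f | f i = f j} ≤
      (Fintype.card α : ℝ≥0∞)⁻¹ := by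
  classical
  have hsub : {f : ι → α | f i = f j} ⊆
      ⋃ a, (({i, j} : Finset ι) : Set ι).pi fun _ => {a} := by
    intro f hf
    refine Set.mem_iUnion.2 ⟨f i, ?_⟩
    simpa [Set.mem_pi] using Eq.symm hf
  refine (measure_mono hsub).trans ((measure_iUnion_fintype_le _ _).trans (le_of_eq ?_))
  have hone (a : α) : (PMF.uniformOfFintype α).toMeasure {a} = (Fintype.card α : ℝ≥0∞)⁻¹ := by
    rw [PMF.toMeasure_apply_singleton _ _ (measurableSet_singleton a),
      PMF.uniformOfFintype_apply]
  simp_rw [Measure.pi_pi_finset, hone, Finset.prod_const, Finset.card_pair hij, Finset.sum_const,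
    Finset.card_univ, nsmul_eq_mul]
  rw [pow_two, ← mul_assoc, ENNReal.mul_inv_cancel (by simp) (by simp), one_mul]

end

/-- Strict-minimum leader probability with collision loss: under the product of `n`
independent uniform distributions on `Fin m`, each coordinate `q` is the unique
minimizer with probability at least `1/n − (n−1)/m`. -/
theorem strict_min_leader_prob (n m : ℕ) [NeZero n] [NeZero m] (q : Fin n) :
    (1 : ℝ≥0∞) / n - ((n : ℝ≥0∞) - 1) / m ≤
      Measure.pi (fun _ : Fin n => (PMF.uniformOfFintype (Fin m)).toMeasure)
        {f : Fin n → Fin m | ∀ i, i ≠ q → f q < f i} := by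
  set μ := Measure.pi (fun _ : Fin n => (PMF.uniformOfFintype (Fin m)).toMeasure)
  rw [tsub_le_iff_right]
  have hsub : {f : Fin n → Fin m | ∀ k, f q ≤ f k} ⊆
      {f | ∀ i, i ≠ q → f q < f i} ∪ ⋃ i ∈ Finset.univ.erase q, {f | f i = f q} := by
    intro f hf
    by_cases h : ∃ i, i ≠ q ∧ f i = f q
    · obtain ⟨i, hi, hfi⟩ := h
      exact Or.inr (Set.mem_biUnion (by simpa using hi) hfi)
    · push Not at h
      exact Or.inl fun i hi => lt_of_le_of_ne (hf i) (h i hi).symm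
  have hcoll : μ (⋃ i ∈ Finset.univ.erase q, {f | f i = f q}) ≤ ((n : ℝ≥0∞) - 1) / m := by
    refine (measure_biUnion_finset_le _ _).trans ((Finset.sum_le_card_nsmul _ _ _ fun i hi =>
      measure_pi_uniformOfFintype_collision_le (Finset.ne_of_mem_erase hi)).trans (le_of_eq ?_))
    simp [Finset.card_erase_of_mem, div_eq_mul_inv]
  calc (1 : ℝ≥0∞) / n ≤ μ {f | ∀ k, f q ≤ f k} := by
        simpa using inv_card_le_measure_pi_isMin (PMF.uniformOfFintype (Fin m)).toMeasure q
    _ ≤ _ := (measure_mono hsub).trans (measure_union_le _ _)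
    _ ≤ _ := by gcongr
end
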